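/- arXiv:0903.1021 — 8 statements merged into one kernel-verified Lean document; each statement's English description precedes it below -/
import Mathlib

section
/- Let H be a complex inner product space, T : H → H a symmetric linear operator, c ∈ ℂ a scalar, and S, S' : H → H linear operators such that ⟪S x, y⟫ = ⟪x, S' y⟫ for all x, y ∈ H and T ∘ S − S ∘ T = c • id. If ψ ∈ H is an analytic vector for T, then S ψ is an analytic vector for T. -/
open scoped InnerProductSpace

/-- `ψ` is an analytic vector for `T` iff the power series
`∑ (‖Tⁿψ‖/n!)·zⁿ` has nonzero radius of convergence, i.e. converges for some `z > 0`. -/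
def IsAnalyticVector {H : Type*} [NormedAddCommGroup H] [Module ℂ H]
    (T : H →ₗ[ℂ] H) (ψ : H) : Prop :=
  ∃ z : ℝ, 0 < z ∧ Summable fun n : ℕ => ‖(T ^ n) ψ‖ / n.factorial * z ^ n

open scoped Nat

lemma pow_apply_of_commutator {H : Type*} [AddCommGroup H] [Module ℂ H]
    {T S : H →ₗ[ℂ] H} {c : ℂ} (hcomm : T ∘ₗ S - S ∘ₗ T = c • LinearMap.id) (n : ℕ) (x : H) :
    (T ^ n) (S x) = S ((T ^ n) x) + (n * c) • (T ^ (n - 1)) x := by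
  have h (y : H) : T (S y) = S (T y) + c • y := by
    have := LinearMap.congr_fun hcomm y
    simp only [LinearMap.sub_apply, LinearMap.comp_apply, LinearMap.smul_apply,
      LinearMap.id_apply] at this
    rw [← this]; abel
  induction n with
  | zero => simp
  | succ n ih =>
    rw [pow_succ', Module.End.mul_apply, ih, map_add, h, map_smul, Module.End.mul_apply]
    rcases n with _ | n
    · simp
    · simp only [Nat.add_sub_cancel, pow_succ', Module.End.mul_apply]
      push_cast
      module

lemma inner_pow_apply_of_symmetric {H : Type*} [NormedAddCommGroup H] [InnerProductSpace ℂ H]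
    {T : H →ₗ[ℂ] H} (hT : ∀ x y : H, ⟪T x, y⟫_ℂ = ⟪x, T y⟫_ℂ) (n : ℕ) (x y : H) :
    ⟪(T ^ n) x, y⟫_ℂ = ⟪x, (T ^ n) y⟫_ℂ :=
  LinearMap.IsSymmetric.pow (T := T) hT n x y

lemma norm_sq_pow_apply_le {H : Type*} [NormedAddCommGroup H] [InnerProductSpace ℂ H]
    {T S S' : H →ₗ[ℂ] H} (hT : ∀ x y : H, ⟪T x, y⟫_ℂ = ⟪x, T y⟫_ℂ)
    (hS : ∀ x y : H, ⟪S x, y⟫_ℂ = ⟪x, S' y⟫_ℂ) {c : ℂ}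
    (hcomm : T ∘ₗ S - S ∘ₗ T = c • LinearMap.id) (ψ : H) (n : ℕ) :
    ‖(T ^ n) (S ψ)‖ ^ 2 ≤ ‖S' (S ψ)‖ * ‖(T ^ (2 * n)) ψ‖ +
      ‖c‖ * ‖S ψ‖ * ((2 * n : ℕ) * ‖(T ^ (2 * n - 1)) ψ‖) := by
  have h : ⟪(T ^ n) (S ψ), (T ^ n) (S ψ)⟫_ℂ = ⟪(T ^ (2 * n)) (S ψ), S ψ⟫_ℂ := by
    rw [← inner_pow_apply_of_symmetric hT, ← Module.End.mul_apply, ← pow_add, two_mul]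
  rw [pow_apply_of_commutator hcomm (2 * n), inner_add_left, hS] at h
  calc ‖(T ^ n) (S ψ)‖ ^ 2 = ‖⟪(T ^ n) (S ψ), (T ^ n) (S ψ)⟫_ℂ‖ := by
        rw [inner_self_eq_norm_sq_to_K]; simp
    _ ≤ ‖(T ^ (2 * n)) ψ‖ * ‖S' (S ψ)‖ +
        ‖((2 * n : ℕ) * c) • (T ^ (2 * n - 1)) ψ‖ * ‖S ψ‖ := by
        rw [h]
        exact (norm_add_le _ _).trans (add_le_add (norm_inner_le_norm _ _) (norm_inner_le_norm _ _))
    _ = _ := by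
        rw [norm_smul, norm_mul, Complex.norm_natCast]; ring

lemma factorial_two_mul_le (n : ℕ) : (2 * n)! ≤ 4 ^ n * n ! ^ 2 := by
  have h := Nat.choose_mul_factorial_mul_factorial (show n ≤ 2 * n by lia)
  rw [show 2 * n - n = n by lia, mul_assoc, ← sq] at h
  rw [← h]
  gcongr
  have := Nat.choose_le_two_pow (2 * n) n
  rwa [pow_mul] at this

/-- If `T` is symmetric, `S` has an adjoint `S'`, and `[T, S] = c • id`, then `S` maps
analytic vectors for `T` to analytic vectors for `T`. -/
theorem isAnalyticVector_apply {H : Type*} [NormedAddCommGroup H] [InnerProductSpace ℂ H]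
    (T S S' : H →ₗ[ℂ] H) (hT : ∀ x y : H, ⟪T x, y⟫_ℂ = ⟪x, T y⟫_ℂ)
    (hS : ∀ x y : H, ⟪S x, y⟫_ℂ = ⟪x, S' y⟫_ℂ) (c : ℂ)
    (hcomm : T ∘ₗ S - S ∘ₗ T = c • LinearMap.id)
    (ψ : H) (hψ : IsAnalyticVector T ψ) :
    IsAnalyticVector T (S ψ) := by
  obtain ⟨z, hz, hsum⟩ := hψ
  obtain ⟨M, hM⟩ : ∃ M : ℝ, ∀ n : ℕ, ‖(T ^ n) ψ‖ / n ! * z ^ n ≤ M :=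
    ⟨_, fun n => hsum.le_tsum n fun _ _ => by positivity⟩
  have hM0 : 0 ≤ M := le_trans (by positivity) (hM 0)
  have hM' (k : ℕ) : k * ‖(T ^ (k - 1)) ψ‖ / k ! * z ^ k ≤ z * M := by
    rcases k with _ | k
    · simp only [Nat.cast_zero, zero_mul, zero_div]; positivity
    · calc _ = z * (‖(T ^ k) ψ‖ / k ! * z ^ k) := by
            rw [Nat.factorial_succ, Nat.add_sub_cancel]; push_cast; field_simp; ring
        _ ≤ _ := by gcongr; exact hM k
  let K : ℝ := ‖S' (S ψ)‖ * M + ‖c‖ * ‖S ψ‖ * (z * M)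
  have hK (n : ℕ) : ‖(T ^ n) (S ψ)‖ / n ! * (z / 2) ^ n ≤ √K := by
    apply Real.le_sqrt_of_sq_le
    have hf : ((2 * n)! : ℝ) ≤ 4 ^ n * (n ! : ℝ) ^ 2 := mod_cast factorial_two_mul_le n
    calc (‖(T ^ n) (S ψ)‖ / n ! * (z / 2) ^ n) ^ 2
        = ‖(T ^ n) (S ψ)‖ ^ 2 / (4 ^ n * (n ! : ℝ) ^ 2) * z ^ (2 * n) := by
          rw [show (4 : ℝ) = 2 ^ 2 by norm_num, ← pow_mul, mul_pow, div_pow, div_pow, div_pow,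
            ← pow_mul, ← pow_mul, mul_comm n 2]
          field_simp
      _ ≤ (‖S' (S ψ)‖ * ‖(T ^ (2 * n)) ψ‖ +
            ‖c‖ * ‖S ψ‖ * ((2 * n : ℕ) * ‖(T ^ (2 * n - 1)) ψ‖)) / (2 * n)! * z ^ (2 * n) := by
          gcongr
          exact norm_sq_pow_apply_le hT hS hcomm ψ n
      _ = ‖S' (S ψ)‖ * (‖(T ^ (2 * n)) ψ‖ / (2 * n)! * z ^ (2 * n)) + ‖c‖ * ‖S ψ‖ *
            ((2 * n : ℕ) * ‖(T ^ (2 * n - 1)) ψ‖ / (2 * n)! * z ^ (2 * n)) := by ring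
      _ ≤ K := add_le_add (mul_le_mul_of_nonneg_left (hM _) (by positivity))
          (mul_le_mul_of_nonneg_left (hM' _) (by positivity))
  refine ⟨z / 4, by positivity, .of_nonneg_of_le (fun n => by positivity) (fun n => ?_)
    (summable_geometric_two.mul_left √K)⟩
  calc ‖(T ^ n) (S ψ)‖ / n ! * (z / 4) ^ n
      = ‖(T ^ n) (S ψ)‖ / n ! * (z / 2) ^ n * (1 / 2) ^ n := by
        rw [mul_assoc, ← mul_pow]; ring_nf
    _ ≤ √K * (1 / 2) ^ n := by gcongr; exact hK n
end

section
/- Let H be a complex inner product space, V a set, and Φ a map assigning to each h ∈ V a symmetric linear operator Φ(h) : H → H, such that for all f, h ∈ V there exists a scalar c(f,h) ∈ ℂ with Φ(f) ∘ Φ(h) − Φ(h) ∘ Φ(f) = c(f,h) • id. Let Ω ∈ H and f ∈ V, and suppose Ω is an analytic vector for Φ(f). Then for every m ≥ 0 and all h_1, …, h_m ∈ V, the vector Φ(h_m) ∘ ⋯ ∘ Φ(h_1) Ω is an analytic vector for Φ(f); consequently, if the linear span of the vectors Φ(h_m) ∘ ⋯ ∘ Φ(h_1) Ω (over all m ≥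 0 and h_1, …, h_m ∈ V) is dense in H, then the set of analytic vectors for Φ(f) is dense in H. -/
open scoped InnerProductSpace

/-- `ψ` is analytic for `T` iff `‖Tⁿψ‖ ≤ C Rⁿ n!` for some constants `C ≥ 0`, `R ≥ 1`. -/
theorem isAnalyticVector_iff_exists_bound {H : Type*} [NormedAddCommGroup H] [Module ℂ H]
    {T : H →ₗ[ℂ] H} {ψ : H} :
    IsAnalyticVector T ψ ↔
      ∃ C R : ℝ, 0 ≤ C ∧ 1 ≤ R ∧ ∀ n : ℕ, ‖(T ^ n) ψ‖ ≤ C * R ^ n * n.factorial := by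
  constructor
  · rintro ⟨z, hz, hs⟩
    have hterm : ∀ n : ℕ, 0 ≤ ‖(T ^ n) ψ‖ / n.factorial * z ^ n := fun n => by positivity
    refine ⟨∑' n : ℕ, ‖(T ^ n) ψ‖ / n.factorial * z ^ n, max 1 z⁻¹, tsum_nonneg hterm,
      le_max_left _ _, fun n => ?_⟩
    have hn := hs.le_tsum n fun m _ => hterm m
    have hfac : (0 : ℝ) < n.factorial := by positivity
    calc ‖(T ^ n) ψ‖ = ‖(T ^ n) ψ‖ / n.factorial * z ^ n * z⁻¹ ^ n * n.factorial := by
          rw [inv_pow, mul_inv_cancel_right₀ (pow_ne_zero n hz.ne'), div_mul_cancel₀ _ hfac.ne']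
      _ ≤ _ := by
          gcongr
          exact le_max_right _ _
  · rintro ⟨C, R, hC, hR, hb⟩
    have hR0 : 0 < R := by linarith
    refine ⟨(2 * R)⁻¹, by positivity, Summable.of_nonneg_of_le (fun n => by positivity)
      (fun n => ?_) (summable_geometric_two.mul_left C)⟩
    calc ‖(T ^ n) ψ‖ / n.factorial * (2 * R)⁻¹ ^ n
        ≤ C * R ^ n * n.factorial / n.factorial * (2 * R)⁻¹ ^ n := by
          gcongr
          exact hb n
      _ = C * (1 / 2) ^ n := by
          rw [mul_div_cancel_right₀ _ (by positivity), mul_assoc, ← mul_pow]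
          congr 2
          field_simp

/-- The analytic vectors for `T` form a submodule. -/
def analyticVectors {H : Type*} [NormedAddCommGroup H] [NormedSpace ℂ H]
    (T : H →ₗ[ℂ] H) : Submodule ℂ H where
  carrier := {v | IsAnalyticVector T v}
  zero_mem' := ⟨1, one_pos, by simp⟩
  add_mem' := by
    intro v w hv hw
    obtain ⟨C, R, hC, hR, hb⟩ := isAnalyticVector_iff_exists_bound.1 hv
    obtain ⟨D, S, hD, hS, hd⟩ := isAnalyticVector_iff_exists_bound.1 hw
    refine isAnalyticVector_iff_exists_bound.2
      ⟨C + D, max R S, by positivity, hR.trans (le_max_left _ _), fun n => ?_⟩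
    rw [map_add]
    calc ‖(T ^ n) v + (T ^ n) w‖ ≤ C * R ^ n * n.factorial + D * S ^ n * n.factorial :=
          norm_add_le_of_le (hb n) (hd n)
      _ ≤ C * max R S ^ n * n.factorial + D * max R S ^ n * n.factorial := by
          gcongr
          · exact le_max_left _ _
          · exact le_max_right _ _
      _ = (C + D) * max R S ^ n * n.factorial := by ring
  smul_mem' := by
    intro c v hv
    obtain ⟨C, R, hC, hR, hb⟩ := isAnalyticVector_iff_exists_bound.1 hv
    refine isAnalyticVector_iff_exists_bound.2 ⟨‖c‖ * C, R, by positivity, hR, fun n => ?_⟩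
    rw [map_smul, norm_smul, mul_assoc, mul_assoc, ← mul_assoc C]
    gcongr
    exact hb n

/-- If `[A, B] = c • 1`, then `Aⁿ B = B Aⁿ + n c Aⁿ⁻¹`. -/
theorem pow_mul_eq_of_commutator_eq_smul_one {E : Type*} [Ring E] [Algebra ℂ E]
    {A B : E} {c : ℂ} (hc : A * B - B * A = c • 1) (n : ℕ) :
    A ^ n * B = B * A ^ n + (n * c) • A ^ (n - 1) := by
  have hAB : A * B = B * A + c • 1 := by rw [← hc]; abel
  induction n with
  | zero => simp
  | succ n ih =>
    rw [pow_succ', mul_assoc, ih, mul_add, ← mul_assoc, hAB, add_mul, mul_assoc,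
      mul_smul_comm, smul_mul_assoc, one_mul, add_assoc, ← pow_succ']
    congr 1
    rcases n with _ | n
    · simp
    · simp only [Nat.add_sub_cancel, ← pow_succ', ← add_smul]
      congr 1
      push_cast
      ring

theorem cast_factorial_two_mul_le (n : ℕ) :
    ((2 * n).factorial : ℝ) ≤ 4 ^ n * (n.factorial : ℝ) ^ 2 := by
  have h := Nat.choose_mul_factorial_mul_factorial (show n ≤ 2 * n by lia)
  rw [show 2 * n - n = n by lia] at h
  have h4 : (2 * n).choose n ≤ 4 ^ n := by
    calc (2 * n).choose n ≤ 2 ^ (2 * n) := Nat.choose_le_two_pow _ _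
      _ = 4 ^ n := by rw [pow_mul]; norm_num
  rw [← h, mul_assoc, ← sq]
  exact_mod_cast Nat.mul_le_mul_right _ h4

/-- If `A`, `B` are symmetric with scalar commutator, then `B` preserves the analytic vectors
for `A`. -/
theorem IsAnalyticVector.apply_of_commutator {H : Type*} [NormedAddCommGroup H]
    [InnerProductSpace ℂ H] {A B : H →ₗ[ℂ] H} (hA : A.IsSymmetric) (hB : B.IsSymmetric)
    {c : ℂ} (hc : A * B - B * A = c • 1) {ψ : H} (hψ : IsAnalyticVector A ψ) :
    IsAnalyticVector A (B ψ) := by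
  obtain ⟨C, R, hC, hR, hb⟩ := isAnalyticVector_iff_exists_bound.1 hψ
  have hR0 : 0 < R := by linarith
  have hsq : ∀ n : ℕ, ‖(A ^ n) (B ψ)‖ ^ 2 ≤
      ‖(A ^ (2 * n)) ψ‖ * ‖B (B ψ)‖ +
        (2 * n : ℕ) * ‖c‖ * ‖(A ^ (2 * n - 1)) ψ‖ * ‖B ψ‖ := by
    intro n
    have hcomm : (A ^ (2 * n)) (B ψ) =
        B ((A ^ (2 * n)) ψ) + (((2 * n : ℕ) : ℂ) * c) • (A ^ (2 * n - 1)) ψ := by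
      simpa using LinearMap.congr_fun (pow_mul_eq_of_commutator_eq_smul_one hc (2 * n)) ψ
    have hinner : ⟪(A ^ n) (B ψ), (A ^ n) (B ψ)⟫_ℂ =
        ⟪(A ^ (2 * n)) ψ, B (B ψ)⟫_ℂ +
          ⟪(((2 * n : ℕ) : ℂ) * c) • (A ^ (2 * n - 1)) ψ, B ψ⟫_ℂ := by
      rw [← hA.pow n, ← Module.End.mul_apply, ← pow_add, ← two_mul, hcomm, inner_add_left, hB]
    calc ‖(A ^ n) (B ψ)‖ ^ 2 = ‖⟪(A ^ n) (B ψ), (A ^ n) (B ψ)⟫_ℂ‖ := by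
          rw [inner_self_eq_norm_sq_to_K]
          simp
      _ ≤ ‖(A ^ (2 * n)) ψ‖ * ‖B (B ψ)‖ +
            ‖(((2 * n : ℕ) : ℂ) * c) • (A ^ (2 * n - 1)) ψ‖ * ‖B ψ‖ := by
          rw [hinner]
          exact norm_add_le_of_le (norm_inner_le_norm _ _) (norm_inner_le_norm _ _)
      _ = _ := by rw [norm_smul, norm_mul, Complex.norm_natCast]
  have hlower : ∀ m : ℕ, m * ‖(A ^ (m - 1)) ψ‖ ≤ C * R ^ m * m.factorial := by
    rintro (_ | m)
    · simpa using hC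
    · calc ((m + 1 : ℕ) : ℝ) * ‖(A ^ m) ψ‖ ≤ (m + 1 : ℕ) * (C * R ^ m * m.factorial) := by
            gcongr
            exact hb m
        _ = C * R ^ m * (m + 1).factorial := by
            rw [Nat.factorial_succ]
            push_cast
            ring
        _ ≤ C * R ^ (m + 1) * (m + 1).factorial := by
            gcongr
            · lia
  set K := C * (‖B (B ψ)‖ + ‖c‖ * ‖B ψ‖) with hK
  have hK0 : 0 ≤ K := by positivity
  refine isAnalyticVector_iff_exists_bound.2
    ⟨√K, 2 * R, Real.sqrt_nonneg _, by linarith, fun n => ?_⟩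
  refine le_of_sq_le_sq ?_ (by positivity)
  calc ‖(A ^ n) (B ψ)‖ ^ 2
      ≤ ‖(A ^ (2 * n)) ψ‖ * ‖B (B ψ)‖ +
        ((2 * n : ℕ) * ‖(A ^ (2 * n - 1)) ψ‖) * (‖c‖ * ‖B ψ‖) := (hsq n).trans_eq (by ring)
    _ ≤ (C * R ^ (2 * n) * (2 * n).factorial) * ‖B (B ψ)‖ +
        (C * R ^ (2 * n) * (2 * n).factorial) * (‖c‖ * ‖B ψ‖) := by
        refine add_le_add ?_ ?_ <;> refine mul_le_mul_of_nonneg_right ?_ (by positivity)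
        · exact hb _
        · exact hlower _
    _ = K * R ^ (2 * n) * (2 * n).factorial := by rw [hK]; ring
    _ ≤ K * R ^ (2 * n) * (4 ^ n * (n.factorial : ℝ) ^ 2) := by
        gcongr
        exact cast_factorial_two_mul_le n
    _ = (√K * (2 * R) ^ n * n.factorial) ^ 2 := by
        rw [mul_pow, mul_pow, Real.sq_sqrt hK0, ← pow_mul, mul_pow, mul_comm n 2, pow_mul 2 2 n]
        norm_num
        ring

/-- If `Φ` assigns to each `h ∈ V` a symmetric operator, all commutators `[Φ f, Φ h]` are
scalar, and `Ω` is an analytic vector for `Φ f`, then every vector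
`Φ(h_m) ∘ ⋯ ∘ Φ(h_1) Ω` is an analytic vector for `Φ f`; consequently, if the span of
these vectors is dense, then the analytic vectors for `Φ f` are dense. -/
theorem isAnalyticVector_foldl_and_dense {H : Type*} [NormedAddCommGroup H]
    [InnerProductSpace ℂ H] {V : Type*} (Φ : V → (H →ₗ[ℂ] H))
    (hsymm : ∀ (h : V) (x y : H), ⟪Φ h x, y⟫_ℂ = ⟪x, Φ h y⟫_ℂ)
    (hcomm : ∀ f h : V, ∃ c : ℂ, (Φ f) ∘ₗ (Φ h) - (Φ h) ∘ₗ (Φ f) = c • LinearMap.id)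
    (Ω : H) (f : V) (hΩ : IsAnalyticVector (Φ f) Ω) :
    (∀ L : List V, IsAnalyticVector (Φ f) (L.foldl (fun v h => Φ h v) Ω)) ∧
      (Dense ((Submodule.span ℂ
            {v : H | ∃ L : List V, v = L.foldl (fun w h => Φ h w) Ω} : Submodule ℂ H) : Set H) →
        Dense {v : H | IsAnalyticVector (Φ f) v}) := by
  have hfold : ∀ L : List V, IsAnalyticVector (Φ f) (L.foldl (fun v h => Φ h v) Ω) := by
    intro L
    induction L using List.reverseRecOn with
    | nil => exact hΩ
    | append_singleton L h ih =>
      obtain ⟨c, hc⟩ := hcomm f h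
      rw [List.foldl_append]
      exact ih.apply_of_commutator (hsymm f) (hsymm h) hc
  refine ⟨hfold, fun hdense => hdense.mono ?_⟩
  have hspan : Submodule.span ℂ {v : H | ∃ L : List V, v = L.foldl (fun w h => Φ h w) Ω} ≤
      analyticVectors (Φ f) := by
    rw [Submodule.span_le]
    rintro _ ⟨L, rfl⟩
    exact hfold L
  exact hspan
end

section
/- Let V be a complex vector space, ω = (ω_n)_{n≥1} a family of n-point functionals on V (with the convention ω_0 := 1), and (ω^T_n)_{n≥1} a family of truncated functionals for ω. Then ω satisfies scalar commutation relations if and only if ω^T_n is symmetric for every n ≥ 1 with n ≠ 2. -/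
open scoped BigOperators

/-- `(ωT n)` is a family of truncated functionals for `(ω n)`: for every `n ≥ 1`,
`ω_n(f_n,…,f_1) = ∑_P ∏_{r ∈ P} ω^T_{|r|}(f_{r(|r|)},…,f_{r(1)})`, where `P` runs over
all partitions of `{1,…,n}` into nonempty blocks, each block listed in increasing order.
(Here the multilinear map index `j : Fin n` corresponds to the argument `f_{j+1}`.) -/
def IsTruncatedFamily {V : Type*} [AddCommGroup V] [Module ℂ V]
    (ω ωT : ∀ n, MultilinearMap ℂ (fun _ : Fin n => V) ℂ) : Prop :=
  ∀ (n : ℕ) (f : Fin (n + 1) → V),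
    ω (n + 1) f =
      ∑ P : Finpartition (Finset.univ : Finset (Fin (n + 1))),
        ∏ r ∈ P.parts, ωT r.card (fun j => f (r.orderIsoOfFin rfl j))

/-- The function obtained from `g : Fin (n+2) → V` by omitting the arguments at the
two consecutive positions `p` and `p+1`. -/
def omitTwo {V : Type*} {n : ℕ} (g : Fin (n + 2) → V) (p : Fin (n + 1)) : Fin n → V :=
  fun j => if (j : ℕ) < (p : ℕ) then g ⟨j, by omega⟩ else g ⟨(j : ℕ) + 2, by omega⟩

/-- `ω` satisfies scalar commutation relations: for every `n ≥ 2` and `1 ≤ i < n`,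
`ω_n(f_n,…,f_{i+1},f_i,…,f_1) − ω_n(f_n,…,f_i,f_{i+1},…,f_1)
  = (ω_2(f_{i+1},f_i) − ω_2(f_i,f_{i+1})) · ω_{n−2}(f_n,…,f_{i+2},f_{i−1},…,f_1)`.
(Positions are `0`-based: `p = i − 1`, and the index `j : Fin n` is the argument
`f_{j+1}`.) -/
def SatisfiesScalarCommutationRelations {V : Type*} [AddCommGroup V] [Module ℂ V]
    (ω : ∀ n, MultilinearMap ℂ (fun _ : Fin n => V) ℂ) : Prop :=
  ∀ (n : ℕ) (p : Fin (n + 1)) (g : Fin (n + 2) → V),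
    ω (n + 2) g - ω (n + 2) (g ∘ Equiv.swap p.castSucc p.succ) =
      (ω 2 ![g p.castSucc, g p.succ] - ω 2 ![g p.succ, g p.castSucc]) * ω n (omitTwo g p)

/-- An `n`-point functional is symmetric if it is invariant under every permutation of
its arguments. -/
def IsSymmetricFunctional {V : Type*} [AddCommGroup V] [Module ℂ V] {n : ℕ}
    (w : MultilinearMap ℂ (fun _ : Fin n => V) ℂ) : Prop :=
  ∀ (σ : Equiv.Perm (Fin n)) (f : Fin n → V), w (f ∘ σ) = w f

namespace Finpartition

variable {α β : Type*} [DecidableEq α] [DecidableEq β]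

/-- The image of a partition of a finset under an embedding. -/
def mapEmbedding (e : α ↪ β) {S : Finset α} (P : Finpartition S) : Finpartition (S.map e) :=
  ofExistsUnique (P.parts.map (Finset.mapEmbedding e).toEmbedding)
    (by
      simp only [Finset.mem_map]
      rintro _ ⟨r, hr, rfl⟩
      exact Finset.map_subset_map.2 (P.subset hr))
    (by
      simp only [Finset.mem_map]
      rintro _ ⟨a, ha, rfl⟩
      obtain ⟨r, hr, har⟩ := P.exists_mem ha
      refine ⟨r.map e, ⟨⟨r, hr, rfl⟩, Finset.mem_map_of_mem e har⟩, ?_⟩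
      rintro _ ⟨⟨t, ht, rfl⟩, hat⟩
      have hat' : a ∈ t := (Finset.mem_map' e).1 hat
      rw [P.eq_of_mem_parts hr ht har hat']
      rfl)
    (by
      simp only [Finset.mem_map]
      rintro ⟨r, hr, h⟩
      exact P.ne_empty hr (Finset.map_eq_empty.1 h))

/-- The preimage of a partition of the image of a finset under an embedding. -/
def comapEmbedding (e : α ↪ β) {S : Finset α} (Q : Finpartition (S.map e)) : Finpartition S :=
  ofExistsUnique {r ∈ S.powerset | r.map e ∈ Q.parts}
    (fun r hr => Finset.mem_powerset.1 (Finset.mem_filter.1 hr).1)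
    (by
      intro a ha
      obtain ⟨t, ht, hat⟩ := Q.exists_mem (Finset.mem_map_of_mem e ha)
      obtain ⟨r, hrS, rfl⟩ := Finset.subset_map_iff.1 (Q.subset ht)
      refine ⟨r, ⟨by simp [hrS, ht], (Finset.mem_map' e).1 hat⟩, ?_⟩
      rintro u ⟨hu, hau⟩
      exact Finset.map_injective e (Q.eq_of_mem_parts (Finset.mem_filter.1 hu).2 ht
        (Finset.mem_map_of_mem e hau) hat))
    (by simp)

lemma mapEmbedding_comapEmbedding (e : α ↪ β) {S : Finset α} (Q : Finpartition (S.map e)) :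
    (Q.comapEmbedding e).mapEmbedding e = Q := by
  ext t
  simp only [mapEmbedding, comapEmbedding, ofExistsUnique_parts, Finset.mem_map,
    Finset.mem_filter, Finset.mem_powerset]
  constructor
  · rintro ⟨r, ⟨-, hr⟩, rfl⟩
    exact hr
  · intro ht
    obtain ⟨r, hrS, rfl⟩ := Finset.subset_map_iff.1 (Q.subset ht)
    exact ⟨r, ⟨hrS, ht⟩, rfl⟩

lemma mapEmbedding_injective (e : α ↪ β) {S : Finset α} :
    Function.Injective (mapEmbedding e : Finpartition S → Finpartition (S.map e)) := by
  intro P Q h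
  have := congrArg Finpartition.parts h
  simp only [mapEmbedding, ofExistsUnique_parts, Finset.map_inj] at this
  exact Finpartition.ext this

variable {R : Type*} [CommRing R]

/-- The sum over all partitions of `S` of the product of the weights of the blocks. -/
def partitionSum (F : Finset α → R) (S : Finset α) : R :=
  ∑ P : Finpartition S, ∏ r ∈ P.parts, F r

lemma partitionSum_empty (F : Finset α → R) : partitionSum F ∅ = 1 := by
  have h (P : Finpartition (∅ : Finset α)) : P.parts = ∅ := P.parts_eq_empty_iff.2 rfl
  have : Unique (Finpartition (∅ : Finset α)) := inferInstanceAs (Unique (Finpartition ⊥))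
  simp [partitionSum, h]

lemma partitionSum_congr {F G : Finset α → R} {S : Finset α}
    (h : ∀ r ⊆ S, r.Nonempty → F r = G r) : partitionSum F S = partitionSum G S :=
  Finset.sum_congr rfl fun P _ => Finset.prod_congr rfl fun r hr =>
    h r (P.subset hr) (P.nonempty_of_mem_parts hr)

lemma partitionSum_map (e : α ↪ β) (F : Finset β → R) (S : Finset α) :
    partitionSum F (S.map e) = partitionSum (fun r => F (r.map e)) S := by
  symm
  refine Finset.sum_bij (fun P _ => P.mapEmbedding e) (fun _ _ => Finset.mem_univ _)
    (fun P _ Q _ h => mapEmbedding_injective e h)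
    (fun Q _ => ⟨Q.comapEmbedding e, Finset.mem_univ _, Q.mapEmbedding_comapEmbedding e⟩)
    fun P _ => ?_
  simp [mapEmbedding]

lemma sum_filter_mem_prod_erase (F : Finset α → R) {S B : Finset α} (hB : B.Nonempty)
    (hBS : B ⊆ S) :
    ∑ P : Finpartition S with B ∈ P.parts, ∏ r ∈ P.parts.erase B, F r =
      partitionSum F (S \ B) := by
  have hnot (Q : Finpartition (S \ B)) : B ∉ Q.parts := fun h =>
    hB.ne_empty (Finset.disjoint_self_iff_empty _ |>.1
      (Finset.disjoint_of_subset_left (Q.subset h) Finset.sdiff_disjoint))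
  symm
  refine Finset.sum_bij
    (fun Q _ => Q.extend hB.ne_empty Finset.sdiff_disjoint (Finset.sdiff_union_of_subset hBS))
    (fun Q _ => by simp) (fun P _ Q _ h => ?_) (fun P hP => ?_) fun Q _ => ?_
  · have h' := congrArg (fun T : Finpartition S => T.parts.erase B) h
    simp only [extend_parts, Finset.erase_insert (hnot _)] at h'
    exact Finpartition.ext h'
  · have hBP : B ∈ P.parts := (Finset.mem_filter.1 hP).2
    refine ⟨P.ofSubset (Finset.erase_subset B _) ?_, Finset.mem_univ _, ?_⟩
    · ext a
      simp only [Finset.mem_sup, Finset.mem_erase, id, Finset.mem_sdiff]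
      constructor
      · rintro ⟨r, ⟨hrB, hr⟩, ha⟩
        exact ⟨P.subset hr ha, fun haB => hrB (P.eq_of_mem_parts hr hBP ha haB)⟩
      · rintro ⟨haS, haB⟩
        obtain ⟨r, hr, ha⟩ := P.exists_mem haS
        exact ⟨r, ⟨fun h => haB (h ▸ ha), hr⟩, ha⟩
    · ext1
      simp [Finset.insert_erase hBP]
  · simp [Finset.erase_insert (hnot Q)]

/-- If two weights agree on all blocks other than `B`, the partition sums differ by the difference
of the weights of `B` times the partition sum of the complement of `B`. -/
lemma partitionSum_sub_partitionSum {F G : Finset α → R} {S B : Finset α} (hB : B.Nonempty)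
    (hBS : B ⊆ S) (h : ∀ r, r.Nonempty → r ≠ B → F r = G r) :
    partitionSum F S - partitionSum G S = (F B - G B) * partitionSum F (S \ B) := by
  rw [← sum_filter_mem_prod_erase F hB hBS, Finset.mul_sum, Finset.sum_filter, partitionSum,
    partitionSum, ← Finset.sum_sub_distrib]
  refine Finset.sum_congr rfl fun P _ => ?_
  have hne {r : Finset α} (hr : r ∈ P.parts) : r.Nonempty := P.nonempty_of_mem_parts hr
  split_ifs with hBP
  · have hFG : ∏ r ∈ P.parts.erase B, G r = ∏ r ∈ P.parts.erase B, F r :=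
      Finset.prod_congr rfl fun r hr =>
        (h r (hne (Finset.mem_of_mem_erase hr)) (Finset.ne_of_mem_erase hr)).symm
    rw [← Finset.mul_prod_erase _ F hBP, ← Finset.mul_prod_erase _ G hBP, hFG, sub_mul]
  · rw [sub_eq_zero]
    exact Finset.prod_congr rfl fun r hr => h r (hne hr) fun hrB => hBP (hrB ▸ hr)

end Finpartition

open Finpartition

section BlockValue

variable {V : Type*} [AddCommGroup V] [Module ℂ V]
  (w : ∀ n, MultilinearMap ℂ (fun _ : Fin n => V) ℂ)

/-- The value of the family `w` on the arguments indexed by `r`, listed in increasing order. -/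
def blockValue {α : Type*} [LinearOrder α] (g : α → V) (r : Finset α) : ℂ :=
  w r.card (g ∘ r.orderEmbOfFin rfl)

lemma blockValue_eq {α : Type*} [LinearOrder α] (g : α → V) {r : Finset α} {k : ℕ}
    (h : r.card = k) : blockValue w g r = w k (g ∘ r.orderEmbOfFin h) := by
  subst h
  rfl

lemma blockValue_univ {n : ℕ} (g : Fin n → V) : blockValue w g Finset.univ = w n g := by
  rw [blockValue_eq w g (Finset.card_fin n),
    ← Finset.orderEmbOfFin_unique (f := id) _ (fun _ => Finset.mem_univ _) strictMono_id]
  rfl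

lemma blockValue_map_univ {n : ℕ} (σ : Equiv.Perm (Fin n)) (g : Fin n → V) :
    blockValue w g (Finset.univ.map σ.toEmbedding) = w n g := by
  rw [Finset.map_univ_equiv, blockValue_univ]

lemma blockValue_pair {α : Type*} [LinearOrder α] (g : α → V) {a b : α} (h : a < b) :
    blockValue w g {a, b} = w 2 ![g a, g b] := by
  rw [blockValue_eq w g (Finset.card_pair h.ne),
    ← Finset.orderEmbOfFin_unique (f := ![a, b]) _ (by simp [Fin.forall_fin_two])
      (Fin.strictMono_iff_lt_succ.2 (by simpa using h))]
  congr 1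
  funext i
  fin_cases i <;> rfl

lemma blockValue_map {α β : Type*} [LinearOrder α] [LinearOrder β] (e : α ↪ β) (g : β → V)
    {r : Finset α} (he : StrictMonoOn e r) :
    blockValue w g (r.map e) = blockValue w (g ∘ e) r := by
  rw [blockValue_eq w g (r.card_map e),
    ← Finset.orderEmbOfFin_unique (f := e ∘ r.orderEmbOfFin rfl)]
  · rfl
  · exact fun x => Finset.mem_map_of_mem e (r.orderEmbOfFin_mem rfl x)
  · exact fun i j hij => he (r.orderEmbOfFin_mem rfl i) (r.orderEmbOfFin_mem rfl j)
      ((r.orderEmbOfFin rfl).strictMono hij)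

lemma blockValue_map_of_symmetric {α β : Type*} [LinearOrder α] [LinearOrder β] (e : α ↪ β)
    (g : β → V) {r : Finset α} (hw : IsSymmetricFunctional (w r.card)) :
    blockValue w g (r.map e) = blockValue w (g ∘ e) r := by
  have hmem (i : Fin r.card) :
      ∃ j, (r.map e).orderEmbOfFin (r.card_map e) j = e (r.orderEmbOfFin rfl i) := by
    rw [← Set.mem_range, Finset.range_orderEmbOfFin]
    exact Finset.mem_map_of_mem e (r.orderEmbOfFin_mem rfl i)
  choose σ hσ using hmem
  have hinj : Function.Injective σ := fun i j hij =>
    (r.orderEmbOfFin rfl).injective (e.injective (by rw [← hσ, ← hσ, hij]))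
  rw [blockValue_eq w g (r.card_map e),
    ← hw (Equiv.ofBijective σ (Finite.injective_iff_bijective.1 hinj))]
  exact congrArg (w r.card) (funext fun i => congrArg g (hσ i))

end BlockValue

section AdjacentSwap

variable {n : ℕ}

/-- The increasing map `Fin n → Fin (n + 2)` skipping the positions `p` and `p + 1`. -/
def skipTwo (p : Fin (n + 1)) : Fin n ↪o Fin (n + 2) :=
  OrderEmbedding.ofStrictMono
    (fun j => if (j : ℕ) < (p : ℕ) then ⟨j, by omega⟩ else ⟨(j : ℕ) + 2, by omega⟩)
    (by
      intro i j hij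
      rw [Fin.lt_def] at hij
      dsimp only
      split_ifs <;> simp only [Fin.lt_def] <;> omega)

lemma skipTwo_apply (p : Fin (n + 1)) (j : Fin n) :
    skipTwo p j = if (j : ℕ) < (p : ℕ) then ⟨j, by omega⟩ else ⟨(j : ℕ) + 2, by omega⟩ :=
  rfl

lemma skipTwo_ne (p : Fin (n + 1)) (j : Fin n) :
    skipTwo p j ≠ p.castSucc ∧ skipTwo p j ≠ p.succ := by
  rw [skipTwo_apply]
  simp only [ne_eq, Fin.ext_iff]
  split_ifs <;> simp <;> omega

lemma map_skipTwo_univ (p : Fin (n + 1)) :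
    Finset.univ.map (skipTwo p).toEmbedding = Finset.univ \ {p.castSucc, p.succ} := by
  refine Finset.eq_of_subset_of_card_le (fun i hi => ?_) ?_
  · obtain ⟨j, -, rfl⟩ := Finset.mem_map.1 hi
    simpa using skipTwo_ne p j
  · have : p.castSucc ≠ p.succ := (Fin.castSucc_lt_succ).ne
    simp [Finset.card_sdiff_of_subset, Finset.card_pair this]

lemma omitTwo_eq_comp {V : Type*} (g : Fin (n + 2) → V) (p : Fin (n + 1)) :
    omitTwo g p = g ∘ skipTwo p := by
  funext j
  simp only [omitTwo, Function.comp, skipTwo_apply]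
  split_ifs <;> rfl

lemma strictMonoOn_swap_castSucc_succ (p : Fin (n + 1)) {r : Finset (Fin (n + 2))}
    (hr : ¬(p.castSucc ∈ r ∧ p.succ ∈ r)) :
    StrictMonoOn (Equiv.swap p.castSucc p.succ) (r : Set (Fin (n + 2))) := by
  intro i hi j hj hij
  have hne : ¬(i = p.castSucc ∧ j = p.succ) := by
    rintro ⟨rfl, rfl⟩
    exact hr ⟨hi, hj⟩
  simp only [Equiv.swap_apply_def]
  simp only [Fin.ext_iff, Fin.lt_def, Fin.val_castSucc, Fin.val_succ] at hij hne ⊢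
  split_ifs <;> try simp only [Fin.val_castSucc, Fin.val_succ]
  all_goals omega

end AdjacentSwap

lemma isSymmetricFunctional_of_swap {V : Type*} [AddCommGroup V] [Module ℂ V] {n : ℕ}
    {w : MultilinearMap ℂ (fun _ : Fin (n + 1) => V) ℂ}
    (h : ∀ (p : Fin n) (g : Fin (n + 1) → V), w (g ∘ Equiv.swap p.castSucc p.succ) = w g) :
    IsSymmetricFunctional w := by
  intro σ
  have hσ : σ ∈ Submonoid.closure (Set.range fun i : Fin n => Equiv.swap i.castSucc i.succ) := by
    rw [Equiv.Perm.mclosure_swap_castSucc_succ]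
    trivial
  induction hσ using Submonoid.closure_induction with
  | mem τ hτ =>
    obtain ⟨p, rfl⟩ := hτ
    exact h p
  | one => exact fun f => rfl
  | mul σ τ _ _ ihσ ihτ => exact fun f => (ihτ (f ∘ σ)).trans (ihσ f)

section Truncated

variable {V : Type*} [AddCommGroup V] [Module ℂ V]
  {ω ωT : ∀ n, MultilinearMap ℂ (fun _ : Fin n => V) ℂ}

lemma IsTruncatedFamily.eq_partitionSum (hω0 : ∀ v : Fin 0 → V, ω 0 v = 1)
    (htr : IsTruncatedFamily ω ωT) : ∀ {n : ℕ} (g : Fin n → V),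
    ω n g = partitionSum (blockValue ωT g) Finset.univ
  | 0, g => by
    rw [hω0, Finset.univ_eq_empty, partitionSum_empty]
  | n + 1, g => htr n g

lemma IsTruncatedFamily.sub_swap_eq_partitionSum (hω0 : ∀ v : Fin 0 → V, ω 0 v = 1)
    (htr : IsTruncatedFamily ω ωT) {n : ℕ} (σ : Equiv.Perm (Fin n)) (g : Fin n → V) :
    ω n g - ω n (g ∘ σ) =
      partitionSum (fun r => blockValue ωT g (r.map σ.toEmbedding)) Finset.univ -
        partitionSum (blockValue ωT (g ∘ σ)) Finset.univ := by
  rw [htr.eq_partitionSum hω0, htr.eq_partitionSum hω0, ← partitionSum_map,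
    Finset.map_univ_equiv]

/-- The commutators of `ω 2` and `ωT 2` agree. -/
lemma IsTruncatedFamily.two_sub_two (hω0 : ∀ v : Fin 0 → V, ω 0 v = 1)
    (htr : IsTruncatedFamily ω ωT) (x y : V) :
    ω 2 ![x, y] - ω 2 ![y, x] = ωT 2 ![x, y] - ωT 2 ![y, x] := by
  have hswap : ![y, x] = ![x, y] ∘ Equiv.swap (0 : Fin 1).castSucc (0 : Fin 1).succ := by
    funext i
    fin_cases i <;> rfl
  rw [hswap, htr.sub_swap_eq_partitionSum hω0, partitionSum_sub_partitionSum
    Finset.univ_nonempty (Finset.Subset.refl _), Finset.sdiff_self, partitionSum_empty, mul_one,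
    blockValue_map_univ, blockValue_univ]
  refine fun r _ hr => blockValue_map _ _ _ (strictMonoOn_swap_castSucc_succ 0 fun h => hr ?_)
  ext i
  fin_cases i
  · simpa using h.1
  · simpa using h.2

/-- The commutator of `ω` at adjacent positions, when the truncated functionals of smaller order
other than two are symmetric. -/
lemma IsTruncatedFamily.sub_swap (hω0 : ∀ v : Fin 0 → V, ω 0 v = 1)
    (htr : IsTruncatedFamily ω ωT) {n : ℕ} (hn : n ≠ 0)
    (hsymm : ∀ k, 1 ≤ k → k < n + 2 → k ≠ 2 → IsSymmetricFunctional (ωT k))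
    (p : Fin (n + 1)) (g : Fin (n + 2) → V) :
    ω (n + 2) g - ω (n + 2) (g ∘ Equiv.swap p.castSucc p.succ) =
      (ωT (n + 2) g - ωT (n + 2) (g ∘ Equiv.swap p.castSucc p.succ)) +
      (ωT 2 ![g p.castSucc, g p.succ] - ωT 2 ![g p.succ, g p.castSucc]) * ω n (omitTwo g p) := by
  have hlt : p.castSucc < p.succ := Fin.castSucc_lt_succ
  rw [htr.sub_swap_eq_partitionSum hω0]
  set τ := Equiv.swap p.castSucc p.succ with hτ
  set B : Finset (Fin (n + 2)) := {p.castSucc, p.succ} with hB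
  set A : Finset (Fin (n + 2)) → ℂ := fun r => blockValue ωT g (r.map τ.toEmbedding) with hA
  set G := blockValue ωT (g ∘ τ) with hG
  have hcardB : B.card = 2 := Finset.card_pair hlt.ne
  have hBuniv : B ≠ Finset.univ := fun h => by
    have := congrArg Finset.card h
    rw [hcardB, Finset.card_fin] at this
    omega
  have hAG (r : Finset (Fin (n + 2))) (hr : r.Nonempty) (hrB : r ≠ B) (hru : r ≠ Finset.univ) :
      A r = G r := by
    by_cases hmem : p.castSucc ∈ r ∧ p.succ ∈ r
    · refine blockValue_map_of_symmetric _ _ _ (hsymm _ hr.card_pos ?_ fun h2 => hrB ?_)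
      · simpa using Finset.card_lt_univ_of_notMem
          (not_forall.1 (mt Finset.eq_univ_iff_forall.2 hru)).choose_spec
      · refine (Finset.eq_of_subset_of_card_le (fun i hi => ?_) (by omega)).symm
        rcases Finset.mem_insert.1 hi with rfl | hi
        · exact hmem.1
        · exact Finset.mem_singleton.1 hi ▸ hmem.2
    · exact blockValue_map _ _ _ (strictMonoOn_swap_castSucc_succ p hmem)
  have hAB : A B = ωT 2 ![g p.castSucc, g p.succ] := by
    have : B.map τ.toEmbedding = B := by
      simp [hB, hτ, Finset.pair_comm]
    rw [hA, ← blockValue_pair ωT g hlt]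
    exact congrArg _ this
  have hGB : G B = ωT 2 ![g p.succ, g p.castSucc] := by
    rw [hG, hB, blockValue_pair ωT _ hlt]
    simp [hτ]
  have hcompl : partitionSum A (Finset.univ \ B) = ω n (omitTwo g p) := by
    rw [← map_skipTwo_univ, partitionSum_map, htr.eq_partitionSum hω0]
    refine partitionSum_congr fun r _ _ => ?_
    have hfix : (r.map (skipTwo p).toEmbedding).map τ.toEmbedding =
        r.map (skipTwo p).toEmbedding := by
      rw [Finset.map_map]
      congr 1
      ext1 j
      exact Equiv.swap_apply_of_ne_of_ne (skipTwo_ne p j).1 (skipTwo_ne p j).2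
    simp only [hA, hfix]
    rw [blockValue_map _ _ _ ((skipTwo p).strictMono.strictMonoOn _), omitTwo_eq_comp]
    rfl
  have hfirst := partitionSum_sub_partitionSum (F := A)
    (G := Function.update G Finset.univ (A Finset.univ)) (S := Finset.univ)
    (B := B) ⟨p.castSucc, by simp [hB]⟩ (Finset.subset_univ _) fun r hr hrB => by
      by_cases hru : r = Finset.univ
      · simp [hru]
      · rw [Function.update_of_ne hru, hAG r hr hrB hru]
  have hsecond := partitionSum_sub_partitionSum
    (F := Function.update G Finset.univ (A Finset.univ)) (G := G) (S := Finset.univ)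
    Finset.univ_nonempty (Finset.Subset.refl _) fun r _ hru => Function.update_of_ne hru _ _
  rw [Function.update_of_ne hBuniv, hAB, hGB, hcompl] at hfirst
  rw [Function.update_self, Finset.sdiff_self, partitionSum_empty, mul_one] at hsecond
  have hAuniv : A Finset.univ = ωT (n + 2) g := blockValue_map_univ ωT τ g
  have hGuniv : G Finset.univ = ωT (n + 2) (g ∘ τ) := blockValue_univ ωT _
  linear_combination hfirst + hsecond + hAuniv - hGuniv

end Truncated

/-- A state is a generalised free field state (satisfies scalar commutation relations)
iff all its truncated `n`-point functionals with `n ≠ 2` are symmetric. -/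
theorem satisfiesSCR_iff_truncated_symmetric {V : Type*} [AddCommGroup V] [Module ℂ V]
    (ω ωT : ∀ n, MultilinearMap ℂ (fun _ : Fin n => V) ℂ)
    (hω0 : ∀ v : Fin 0 → V, ω 0 v = 1)
    (htr : IsTruncatedFamily ω ωT) :
    SatisfiesScalarCommutationRelations ω ↔
      ∀ n : ℕ, 1 ≤ n → n ≠ 2 → IsSymmetricFunctional (ωT n) := by
  constructor
  · intro hscr n
    induction n using Nat.strong_induction_on with
    | _ n ih =>
      intro hn1 hn2
      obtain rfl | hn : n = 1 ∨ 3 ≤ n := by omega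
      · intro σ f
        rw [Subsingleton.elim σ 1]
        rfl
      · obtain ⟨m, rfl⟩ : ∃ m, n = m + 2 := ⟨n - 2, by omega⟩
        refine isSymmetricFunctional_of_swap fun p g => ?_
        have hcomm := htr.sub_swap hω0 (by omega) (fun k h1 hk h2 => ih k hk h1 h2) p g
        rw [hscr m p g, htr.two_sub_two hω0] at hcomm
        linear_combination hcomm
  · intro hsymm n p g
    rw [htr.two_sub_two hω0]
    rcases eq_or_ne n 0 with rfl | hn
    · have hp : p = 0 := Fin.fin_one_eq_zero p
      subst hp
      rw [hω0, mul_one, ← htr.two_sub_two hω0]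
      congr 2 <;> · funext i; fin_cases i <;> rfl
    · rw [htr.sub_swap hω0 hn (fun k h1 _ h2 => hsymm k h1 h2),
        hsymm (n + 2) (by omega) (by omega), sub_self, zero_add]
end

section
/- Let V be a complex vector space, ω = (ω_n)_{n≥1} a family of n-point functionals on V, (ω^T_n)_{n≥1} a family of truncated functionals for ω, and K : V → V a linear map. If ω_n(f_n, …, f_2, K f_1) = 0 for every n ≥ 1 and all f_1, …, f_n ∈ V, then ω^T_n(f_n, …, f_2, K f_1) = 0 for every n ≥ 1 and all f_1, …, f_n ∈ V. -/
open scoped BigOperators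

/-- A finite partition having the whole set as a block is the one-block partition. -/
theorem Finpartition.eq_indiscrete_of_mem_parts {α : Type*} [DecidableEq α] {s : Finset α}
    (hs : s ≠ ⊥) (P : Finpartition s) (h : s ∈ P.parts) : P = Finpartition.indiscrete hs := by
  ext r
  rw [Finpartition.indiscrete_parts, Finset.mem_singleton]
  refine ⟨fun hr => ?_, fun hr => hr ▸ h⟩
  obtain ⟨a, ha⟩ := P.nonempty_of_mem_parts hr
  exact P.eq_of_mem_parts hr h ha (P.le hr ha)

/-- The increasing enumeration of a finset may be indexed by any `Fin m` with `m` its size. -/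
theorem multilinear_orderIsoOfFin_eq {V : Type*} [AddCommGroup V] [Module ℂ V]
    (ω : ∀ n, MultilinearMap ℂ (fun _ : Fin n => V) ℂ) {ι : Type*} [LinearOrder ι]
    (g : ι → V) (r : Finset ι) {m : ℕ} (hm : r.card = m) :
    ω r.card (fun j => g (r.orderIsoOfFin rfl j)) = ω m (fun j => g (r.orderEmbOfFin hm j)) := by
  subst hm
  rfl

/-- If `ω` vanishes on every tuple whose argument of index `0` lies in `S`,
then so do the truncated functionals. -/
theorem IsTruncatedFamily.eq_zero_of_first_mem {V : Type*} [AddCommGroup V] [Module ℂ V]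
    {ω ωT : ∀ n, MultilinearMap ℂ (fun _ : Fin n => V) ℂ}
    (htr : IsTruncatedFamily ω ωT) {S : Set V}
    (h : ∀ (n : ℕ) (g : Fin (n + 1) → V), g 0 ∈ S → ω (n + 1) g = 0)
    (n : ℕ) (g : Fin (n + 1) → V) (hg : g 0 ∈ S) : ωT (n + 1) g = 0 := by
  induction n using Nat.strong_induction_on with
  | _ n ih =>
    have hne : (Finset.univ : Finset (Fin (n + 1))) ≠ ⊥ := Finset.univ_nonempty.ne_empty
    have key := htr n g
    rw [h n g hg, Finset.sum_eq_single (Finpartition.indiscrete hne)] at key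
    · rw [Finpartition.indiscrete_parts, Finset.prod_singleton,
        multilinear_orderIsoOfFin_eq ωT g _ (Finset.card_fin (n + 1))] at key
      have hid : (fun j : Fin (n + 1) => j) =
          Finset.univ.orderEmbOfFin (Finset.card_fin (n + 1)) :=
        Finset.orderEmbOfFin_unique _ (fun _ => Finset.mem_univ _) strictMono_id
      rw [← hid] at key
      exact key.symm
    · intro P _ hP
      obtain ⟨r, hr, h0⟩ := P.exists_mem (Finset.mem_univ 0)
      have hlt : r.card < n + 1 := by
        refine lt_of_le_of_ne (by simpa using r.card_le_univ) fun hc => hP ?_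
        have hu : r = Finset.univ := (Finset.card_eq_iff_eq_univ r).mp (by simpa using hc)
        exact P.eq_indiscrete_of_mem_parts hne (hu ▸ hr)
      obtain ⟨m, hm⟩ := Nat.exists_eq_succ_of_ne_zero (Finset.card_ne_zero_of_mem h0)
      refine Finset.prod_eq_zero hr ?_
      rw [multilinear_orderIsoOfFin_eq ωT g r hm]
      refine ih m (by omega) _ ?_
      have hmin : r.orderEmbOfFin hm 0 = 0 :=
        (Finset.orderEmbOfFin_zero hm m.succ_pos).trans
          (le_antisymm (r.min'_le 0 h0) (Fin.zero_le _))
      rwa [hmin]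
    · exact fun hu => absurd (Finset.mem_univ _) hu

/-- If every `n`-point functional `ω_n` vanishes whenever its first (rightmost) argument
is of the form `K f₁`, then the same holds for the truncated functionals `ω^T_n`. -/
theorem truncated_vanish_of_vanish_first {V : Type*} [AddCommGroup V] [Module ℂ V]
    (ω ωT : ∀ n, MultilinearMap ℂ (fun _ : Fin n => V) ℂ)
    (htr : IsTruncatedFamily ω ωT) (K : V →ₗ[ℂ] V)
    (h : ∀ (n : ℕ) (f : Fin (n + 1) → V),
      ω (n + 1) (Function.update f 0 (K (f 0))) = 0) :
    ∀ (n : ℕ) (f : Fin (n + 1) → V),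
      ωT (n + 1) (Function.update f 0 (K (f 0))) = 0 := by
  intro n f
  refine htr.eq_zero_of_first_mem (S := Set.range K) ?_ n _ ⟨f 0, by simp⟩
  rintro m g ⟨v, hv⟩
  simpa [hv] using h m (Function.update g 0 v)
end

section
/- Let V be a complex vector space, ω = (ω_n)_{n≥1} a family of n-point functionals on V (with the convention ω_0 := 1), (ω^T_n)_{n≥1} a family of truncated functionals for ω, and K : V → V a linear map. Assume: (a) ω_n(f_n, …, f_2, K f_1) = 0 for every n ≥ 1 and all f_1, …, f_n ∈ V; (b) ω_2(K f_2, f_1) = 0 for all f_1, f_2 ∈ V; (c) ω^T_n is symmetric for every n ≥ 1 with n ≠ 2. Then for every n ≥ 1, every 1 ≤ i ≤ n and all f_1, …, f_n ∈ V one has ω_n(f_n, …, f_{i+1}, K f_i, f_{i−1}, …, f_1) = 0. -/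
open scoped BigOperators

/-- The factor contributed by the full block is the functional itself. -/
theorem block_univ_apply {V : Type*} [AddCommGroup V] [Module ℂ V]
    (w : ∀ n, MultilinearMap ℂ (fun _ : Fin n => V) ℂ) {m : ℕ} (f : Fin m → V) :
    w (Finset.univ : Finset (Fin m)).card
      (fun j => f ((Finset.univ : Finset (Fin m)).orderIsoOfFin rfl j)) = w m f := by
  have key : ∀ (k : ℕ) (h : (Finset.univ : Finset (Fin m)).card = k),
      w (Finset.univ : Finset (Fin m)).card
        (fun j => f ((Finset.univ : Finset (Fin m)).orderIsoOfFin rfl j)) =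
      w k (fun j => f ((Finset.univ : Finset (Fin m)).orderIsoOfFin h j)) := by
    rintro k rfl
    rfl
  rw [key m (Finset.card_fin m)]
  congr 1
  funext j
  have h := Finset.orderEmbOfFin_unique (Finset.card_fin m) (f := id)
    (fun _ => Finset.mem_univ _) strictMono_id
  rw [Finset.coe_orderIsoOfFin_apply, ← h, id]

/-- If every proper block through `i` contributes zero, only the one-block partition survives in
the cluster expansion. -/
theorem IsTruncatedFamily.eq_truncated {V : Type*} [AddCommGroup V] [Module ℂ V]
    {ω ωT : ∀ n, MultilinearMap ℂ (fun _ : Fin n => V) ℂ}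
    (htr : IsTruncatedFamily ω ωT) {n : ℕ} (f : Fin (n + 1) → V) (i : Fin (n + 1))
    (h : ∀ r : Finset (Fin (n + 1)), i ∈ r → r.card < n + 1 →
      ωT r.card (fun j => f (r.orderIsoOfFin rfl j)) = 0) :
    ω (n + 1) f = ωT (n + 1) f := by
  have hne : (Finset.univ : Finset (Fin (n + 1))) ≠ ⊥ := Finset.univ_nonempty.ne_empty
  rw [htr, Finset.sum_eq_single (Finpartition.indiscrete hne)]
  · rw [Finpartition.indiscrete_parts, Finset.prod_singleton, block_univ_apply]
  · intro P _ hP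
    obtain ⟨r, hr, hir⟩ := P.exists_mem (Finset.mem_univ i)
    refine Finset.prod_eq_zero hr (h r hir ?_)
    by_contra! hcard
    have hru : r = Finset.univ := by
      rw [← Finset.card_eq_iff_eq_univ, Fintype.card_fin]
      exact le_antisymm (card_finset_fin_le r) hcard
    refine hP (Finpartition.ext (Finset.eq_singleton_iff_unique_mem.2 ⟨hru ▸ hr, ?_⟩))
    intro s hs
    obtain ⟨x, hx⟩ := P.nonempty_of_mem_parts hs
    rw [← hru]
    exact P.eq_of_mem_parts hs hr hx (hru ▸ Finset.mem_univ x)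
  · simp

/-- If `ω` vanishes whenever its first argument lies in `S`, so do the truncated functionals. -/
theorem IsTruncatedFamily.truncated_eq_zero {V : Type*} [AddCommGroup V] [Module ℂ V]
    {ω ωT : ∀ n, MultilinearMap ℂ (fun _ : Fin n => V) ℂ}
    (htr : IsTruncatedFamily ω ωT) {S : Set V}
    (hS : ∀ (n : ℕ) (f : Fin (n + 1) → V), f 0 ∈ S → ω (n + 1) f = 0)
    (n : ℕ) (f : Fin n → V) (i : Fin n) (hi : (i : ℕ) = 0) (hf : f i ∈ S) : ωT n f = 0 := by
  induction n using Nat.strong_induction_on with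
  | _ n ih =>
    obtain _ | n := n
    · exact i.elim0
    obtain rfl : i = 0 := Fin.ext hi
    rw [← htr.eq_truncated f 0, hS n f hf]
    intro r hr hcard
    refine ih _ hcard _ ⟨0, Finset.card_pos.2 ⟨0, hr⟩⟩ rfl ?_
    rw [Finset.coe_orderIsoOfFin_apply, Finset.orderEmbOfFin_zero rfl]
    rwa [← le_antisymm (Finset.min'_le r 0 hr) (Fin.zero_le _)] at hf

/-- If the truncated functionals vanish whenever some argument lies in `S`, so does `ω`. -/
theorem IsTruncatedFamily.eq_zero {V : Type*} [AddCommGroup V] [Module ℂ V]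
    {ω ωT : ∀ n, MultilinearMap ℂ (fun _ : Fin n => V) ℂ}
    (htr : IsTruncatedFamily ω ωT) {S : Set V}
    (hS : ∀ (n : ℕ) (f : Fin n → V) (i : Fin n), f i ∈ S → ωT n f = 0)
    {n : ℕ} (f : Fin (n + 1) → V) (i : Fin (n + 1)) (hf : f i ∈ S) : ω (n + 1) f = 0 := by
  rw [htr]
  refine Finset.sum_eq_zero fun P _ => ?_
  obtain ⟨r, hr, hir⟩ := P.exists_mem (Finset.mem_univ i)
  refine Finset.prod_eq_zero hr (hS _ _ ((r.orderIsoOfFin rfl).symm ⟨i, hir⟩) ?_)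
  simpa using hf

/-- If (a) every `ω_n` vanishes when its first (rightmost) argument is `K f₁`,
(b) `ω_2(K f₂, f₁) = 0`, and (c) every truncated functional `ω^T_n` with `n ≠ 2` is
symmetric, then every `ω_n` vanishes whenever any one of its arguments is of the form
`K f_i`. -/
theorem vanish_in_all_slots {V : Type*} [AddCommGroup V] [Module ℂ V]
    (ω ωT : ∀ n, MultilinearMap ℂ (fun _ : Fin n => V) ℂ)
    (htr : IsTruncatedFamily ω ωT) (K : V →ₗ[ℂ] V)
    (ha : ∀ (n : ℕ) (f : Fin (n + 1) → V),
      ω (n + 1) (Function.update f 0 (K (f 0))) = 0)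
    (hb : ∀ f₁ f₂ : V, ω 2 ![f₁, K f₂] = 0)
    (hc : ∀ n : ℕ, 1 ≤ n → n ≠ 2 → IsSymmetricFunctional (ωT n)) :
    ∀ (n : ℕ) (f : Fin (n + 1) → V) (i : Fin (n + 1)),
      ω (n + 1) (Function.update f i (K (f i))) = 0 := by
  have ha' : ∀ (n : ℕ) (f : Fin (n + 1) → V), f 0 ∈ Set.range K → ω (n + 1) f = 0 := by
    rintro n f ⟨v, hv⟩
    simpa [hv] using ha n (Function.update f 0 v)
  have hfirst := htr.truncated_eq_zero ha'
  have hall : ∀ (n : ℕ) (f : Fin n → V) (i : Fin n), f i ∈ Set.range K → ωT n f = 0 := by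
    intro n f i hf
    by_cases hn : n = 2
    · subst hn
      obtain rfl | rfl : i = 0 ∨ i = 1 := by fin_cases i <;> simp
      · exact hfirst 2 f 0 rfl hf
      rw [← htr.eq_truncated f 1]
      · obtain ⟨v, hv⟩ := hf
        rw [← hb (f 0) v, hv]
        congr 1
        funext j
        fin_cases j <;> rfl
      · intro r hr hcard
        have hpos : 0 < r.card := Finset.card_pos.2 ⟨1, hr⟩
        have hr1 : r = {1} := (Finset.eq_of_subset_of_card_le
          (Finset.singleton_subset_iff.2 hr) (by simp; omega)).symm
        subst hr1
        refine hfirst _ _ ⟨0, hpos⟩ rfl ?_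
        rwa [Finset.mem_singleton.1 (Finset.coe_mem _)]
    · have h0 : 0 < n := i.pos
      rw [← hc n h0 hn (Equiv.swap ⟨0, h0⟩ i) f]
      refine hfirst n _ ⟨0, h0⟩ rfl ?_
      simpa using hf
  intro n f i
  exact htr.eq_zero hall _ i (by simp)
end

section
/- Let H be a complex inner product space, V a set, and Φ a map assigning to each f ∈ V a symmetric linear operator Φ(f) : H → H, such that for all f, h ∈ V there exists a scalar c(f,h) ∈ ℂ with Φ(f) ∘ Φ(h) − Φ(h) ∘ Φ(f) = c(f,h) • id. Let Ω ∈ H with Ω ≠ 0, and let K : V → V be a map such that Φ(K f) Ω = 0 for every f ∈ V. Then for every n ≥ 1, all f_1, …, f_n ∈ V and every 1 ≤ i ≤ n one has ⟪Ω, Φ(f_n) ∘ ⋯ ∘ Φ(f_{i+1}) ∘ Φ(K f_i) ∘ Φ(f_{i−1}) ∘ ⋯ ∘ Φ(f_1) Ω⟫ = 0. -/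
open scoped InnerProductSpace

/-- A symmetric operator `A` that annihilates a nonzero vector and whose commutator with an operator
`B` is scalar commutes with `B`. -/
theorem LinearMap.IsSymmetric.commute_of_commutator_eq_smul_id {𝕜 E : Type*} [RCLike 𝕜]
    [NormedAddCommGroup E] [InnerProductSpace 𝕜 E] {A B : E →ₗ[𝕜] E} (hA : A.IsSymmetric)
    {c : 𝕜} (hAB : A ∘ₗ B - B ∘ₗ A = c • LinearMap.id) {x : E} (hx : x ≠ 0) (hAx : A x = 0) :
    Commute A B := by
  have hvec : A (B x) = c • x := by
    simpa [hAx] using LinearMap.congr_fun hAB x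
  have hc : c = 0 := by
    have h := hA x (B x)
    rw [hAx, inner_zero_left, hvec, inner_smul_right] at h
    exact (mul_eq_zero.mp h.symm).resolve_right (inner_self_ne_zero.mpr hx)
  rw [hc, zero_smul, sub_eq_zero] at hAB
  exact hAB

/-- Applying a list of linear maps to `v` gives zero if one of them annihilates `v` and commutes
with all the others. -/
theorem List.foldl_apply_eq_zero_of_commute {R M V : Type*} [Semiring R] [AddCommMonoid M]
    [Module R M] (Φ : V → Module.End R M) {g : V} (hg : ∀ h, Commute (Φ g) (Φ h)) {l : List V}
    (hl : g ∈ l) {v : M} (hv : Φ g v = 0) : l.foldl (fun w h => Φ h w) v = 0 := by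
  induction l generalizing v with
  | nil => simp at hl
  | cons h t ih =>
    rw [List.foldl_cons]
    rcases List.mem_cons.mp hl with rfl | ht
    · rw [hv]
      exact List.foldl_fixed' (fun k => map_zero (Φ k)) t
    · refine ih ht ?_
      rw [← Module.End.mul_apply, (hg h).eq, Module.End.mul_apply, hv, map_zero]

/-- If each `Φ f` is a symmetric operator, all commutators `[Φ f, Φ h]` are scalar,
`Ω ≠ 0` and `Φ (K f) Ω = 0` for all `f`, then every correlation function of the `Φ f`'s
in the vector `Ω` vanishes as soon as one of the entries is of the form `K f_i`.
(The list is applied from the left: index `0` corresponds to the rightmost field.) -/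
theorem correlation_vanishes_of_annihilates {H : Type*} [NormedAddCommGroup H]
    [InnerProductSpace ℂ H] {V : Type*} (Φ : V → (H →ₗ[ℂ] H))
    (hsymm : ∀ (h : V) (x y : H), ⟪Φ h x, y⟫_ℂ = ⟪x, Φ h y⟫_ℂ)
    (hcomm : ∀ f h : V, ∃ c : ℂ, (Φ f) ∘ₗ (Φ h) - (Φ h) ∘ₗ (Φ f) = c • LinearMap.id)
    (Ω : H) (hΩ : Ω ≠ 0) (K : V → V)
    (hK : ∀ f : V, Φ (K f) Ω = 0) :
    ∀ (n : ℕ) (f : Fin (n + 1) → V) (i : Fin (n + 1)),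
      ⟪Ω, (List.ofFn fun j : Fin (n + 1) => if j = i then K (f j) else f j).foldl
          (fun v h => Φ h v) Ω⟫_ℂ = 0 := by
  intro n f i
  have hcommute : ∀ h, Commute (Φ (K (f i))) (Φ h) := fun h => by
    obtain ⟨c, hc⟩ := hcomm (K (f i)) h
    exact LinearMap.IsSymmetric.commute_of_commutator_eq_smul_id (hsymm _) hc hΩ (hK _)
  have hmem : K (f i) ∈ List.ofFn fun j : Fin (n + 1) => if j = i then K (f j) else f j :=
    List.mem_ofFn.mpr ⟨i, if_pos rfl⟩
  rw [List.foldl_apply_eq_zero_of_commute Φ hcommute hmem (hK _), inner_zero_right]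
end

section
/- For every natural number n and all complex numbers u, v, the series ∑_{j=0}^∞ (eʲ·u + v)ⁿ / j! converges absolutely and e^{−1} · ∑_{j=0}^∞ (eʲ·u + v)ⁿ / j! = ∑_{k=0}^{n} (n choose k) · e^{e^k − 1} · u^k · v^{n−k}. -/
open scoped BigOperators

/-- Expanding `(qʲ·u + v)ⁿ` by the binomial theorem and summing over `j` termwise. -/
theorem hasSum_pow_mul_add_pow_div_factorial (n : ℕ) (q u v : ℂ) :
    HasSum (fun j : ℕ => (q ^ j * u + v) ^ n / (j.factorial : ℂ))
      (∑ k ∈ Finset.range (n + 1),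
        (n.choose k : ℂ) * Complex.exp (q ^ k) * u ^ k * v ^ (n - k)) := by
  have hterm (k : ℕ) : HasSum
      (fun j : ℕ => (n.choose k : ℂ) * ((q ^ k) ^ j / (j.factorial : ℂ)) * u ^ k * v ^ (n - k))
      ((n.choose k : ℂ) * Complex.exp (q ^ k) * u ^ k * v ^ (n - k)) := by
    have h := NormedSpace.expSeries_div_hasSum_exp (q ^ k)
    rw [← Complex.exp_eq_exp_ℂ] at h
    exact ((h.mul_left _).mul_right _).mul_right _
  refine (hasSum_sum fun k _ => hterm k).congr_fun fun j => ?_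
  rw [add_pow, Finset.sum_div]
  refine Finset.sum_congr rfl fun k _ => ?_
  rw [mul_pow, ← pow_mul, ← pow_mul, mul_comm j k]
  ring

/-- For every `n : ℕ` and `u v : ℂ`, the series `∑_j (eʲ·u + v)ⁿ / j!` converges
absolutely and `e⁻¹ · ∑_j (eʲ·u + v)ⁿ / j! = ∑_{k=0}^n (n choose k)·e^{eᵏ−1}·uᵏ·v^{n−k}`. -/
theorem tsum_exp_pow_eq (n : ℕ) (u v : ℂ) :
    Summable (fun j : ℕ => ‖(((Real.exp 1 : ℝ) : ℂ) ^ j * u + v) ^ n / (j.factorial : ℂ)‖) ∧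
      ((Real.exp 1 : ℝ) : ℂ)⁻¹ *
          ∑' j : ℕ, (((Real.exp 1 : ℝ) : ℂ) ^ j * u + v) ^ n / (j.factorial : ℂ) =
        ∑ k ∈ Finset.range (n + 1),
          (n.choose k : ℂ) * ((Real.exp (Real.exp 1 ^ k - 1) : ℝ) : ℂ) *
            u ^ k * v ^ (n - k) := by
  have h := hasSum_pow_mul_add_pow_div_factorial n ((Real.exp 1 : ℝ) : ℂ) u v
  refine ⟨h.summable.norm, ?_⟩
  rw [h.tsum_eq, Finset.mul_sum]
  refine Finset.sum_congr rfl fun k _ => ?_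
  rw [Real.exp_sub]
  push_cast
  ring
end

section
/- Let V be a complex vector space and (ω_n)_{n≥1} any family of n-point functionals on V. Then there exists a unique family (ω^T_n)_{n≥1} of n-point functionals on V that is a family of truncated functionals for ω. -/
open scoped BigOperators

/-- The product `∏ r ∈ P.parts, g_{|r|}(f_r)` over the blocks of a partition `P`, as a multilinear
map in `f`. -/
def partitionProd {V : Type*} [AddCommGroup V] [Module ℂ V]
    (g : ∀ n, MultilinearMap ℂ (fun _ : Fin n => V) ℂ) {n : ℕ}
    (P : Finpartition (Finset.univ : Finset (Fin n))) :
    MultilinearMap ℂ (fun _ : Fin n => V) ℂ :=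
  have key (f : Fin n → V) (i : Fin n) : ∃ (L : V →ₗ[ℂ] ℂ), ∀ x,
      ∏ r ∈ P.parts, g r.card (fun j => Function.update f i x (r.orderIsoOfFin rfl j)) = L x := by
    classical
    obtain ⟨s, hs, his⟩ := P.exists_mem (Finset.mem_univ i)
    obtain ⟨k, hk⟩ := (s.orderIsoOfFin rfl).surjective ⟨i, his⟩
    refine ⟨(∏ r ∈ P.parts.erase s, g r.card (fun j => f (r.orderIsoOfFin rfl j))) •
      (g s.card).toLinearMap (fun j => f (s.orderIsoOfFin rfl j)) k, fun x => ?_⟩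
    rw [← Finset.prod_erase_mul _ _ hs, LinearMap.smul_apply, smul_eq_mul,
      MultilinearMap.toLinearMap_apply]
    congr 1
    · refine Finset.prod_congr rfl fun r hr => ?_
      obtain ⟨hrs, hr⟩ := Finset.mem_erase.1 hr
      congr 1
      funext j
      refine Function.update_of_ne ?_ _ _
      intro h
      have hir : i ∈ r := h ▸ (r.orderIsoOfFin rfl j).2
      exact hrs (P.eq_of_mem_parts hr hs hir his)
    · congr 1
      have hinj : Function.Injective fun j => (s.orderIsoOfFin rfl j : Fin n) :=
        Subtype.val_injective.comp (s.orderIsoOfFin rfl).injective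
      have hki : i = (s.orderIsoOfFin rfl k : Fin n) := by rw [hk]
      subst hki
      exact Function.update_comp_eq_of_injective f hinj k x
  { toFun := fun f => ∏ r ∈ P.parts, g r.card (fun j => f (r.orderIsoOfFin rfl j))
    map_update_add' := fun {inst} f i x y => by
      rw [Subsingleton.elim inst (instDecidableEqFin n)]
      obtain ⟨L, hL⟩ := key f i
      simp only [hL, map_add]
    map_update_smul' := fun {inst} f i c x => by
      rw [Subsingleton.elim inst (instDecidableEqFin n)]
      obtain ⟨L, hL⟩ := key f i
      simp only [hL, map_smul] }

theorem partitionProd_apply {V : Type*} [AddCommGroup V] [Module ℂ V]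
    (g : ∀ n, MultilinearMap ℂ (fun _ : Fin n => V) ℂ) {n : ℕ}
    (P : Finpartition (Finset.univ : Finset (Fin n))) (f : Fin n → V) :
    partitionProd g P f = ∏ r ∈ P.parts, g r.card (fun j => f (r.orderIsoOfFin rfl j)) :=
  rfl

theorem card_lt_of_mem_parts_of_ne {n : ℕ} {P : Finpartition (Finset.univ : Finset (Fin n))}
    (hP : P.parts ≠ {Finset.univ}) {r : Finset (Fin n)} (hr : r ∈ P.parts) : r.card < n := by
  refine lt_of_le_of_ne (card_finset_fin_le r) fun h => hP ?_
  have hru : r = Finset.univ := (Finset.card_eq_iff_eq_univ r).1 (by simpa using h)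
  subst hru
  refine Finset.eq_singleton_iff_unique_mem.2 ⟨hr, fun t ht => ?_⟩
  obtain ⟨a, ha⟩ := P.nonempty_of_mem_parts ht
  exact P.eq_of_mem_parts ht hr ha (Finset.mem_univ a)

/-- The sum of `partitionProd g P` over all partitions `P` with more than one block. -/
def properPartitionSum {V : Type*} [AddCommGroup V] [Module ℂ V]
    (g : ∀ n, MultilinearMap ℂ (fun _ : Fin n => V) ℂ) (n : ℕ) :
    MultilinearMap ℂ (fun _ : Fin n => V) ℂ :=
  ∑ P : Finpartition (Finset.univ : Finset (Fin n)) with P.parts ≠ {Finset.univ},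
    partitionProd g P

theorem properPartitionSum_congr {V : Type*} [AddCommGroup V] [Module ℂ V]
    {g g' : ∀ n, MultilinearMap ℂ (fun _ : Fin n => V) ℂ} {n : ℕ}
    (h : ∀ k, 1 ≤ k → k < n → g k = g' k) :
    properPartitionSum g n = properPartitionSum g' n := by
  refine Finset.sum_congr rfl fun P hP => ?_
  ext f
  rw [partitionProd_apply, partitionProd_apply]
  refine Finset.prod_congr rfl fun r hr => ?_
  rw [h r.card (Finset.card_pos.2 (P.nonempty_of_mem_parts hr))
    (card_lt_of_mem_parts_of_ne (Finset.mem_filter.1 hP).2 hr)]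

theorem apply_orderIsoOfFin_univ {V : Type*} [AddCommGroup V] [Module ℂ V]
    (g : ∀ n, MultilinearMap ℂ (fun _ : Fin n => V) ℂ) {n : ℕ} (f : Fin n → V) :
    g (Finset.univ : Finset (Fin n)).card
      (fun j => f ((Finset.univ : Finset (Fin n)).orderIsoOfFin rfl j)) = g n f := by
  have cast_card : ∀ (k : ℕ) (hk : (Finset.univ : Finset (Fin n)).card = k),
      g (Finset.univ : Finset (Fin n)).card
        (fun j => f ((Finset.univ : Finset (Fin n)).orderIsoOfFin rfl j)) =
      g k (fun j => f ((Finset.univ : Finset (Fin n)).orderIsoOfFin hk j)) := by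
    rintro _ rfl
    rfl
  rw [cast_card n (Finset.card_fin n)]
  congr 1
  funext j
  have hid := Finset.orderEmbOfFin_unique (Finset.card_fin n) (f := id)
    (fun _ => Finset.mem_univ _) strictMono_id
  exact congrArg f (congrFun hid j).symm

theorem sum_partitionProd {V : Type*} [AddCommGroup V] [Module ℂ V]
    (g : ∀ n, MultilinearMap ℂ (fun _ : Fin n => V) ℂ) (n : ℕ) :
    ∑ P : Finpartition (Finset.univ : Finset (Fin (n + 1))), partitionProd g P =
      g (n + 1) + properPartitionSum g (n + 1) := by
  rw [properPartitionSum, ← Finset.sum_filter_add_sum_filter_not Finset.univ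
    (fun P : Finpartition (Finset.univ : Finset (Fin (n + 1))) => P.parts = {Finset.univ})]
  congr 1
  have hne : (Finset.univ : Finset (Fin (n + 1))) ≠ ⊥ := Finset.univ_nonempty.ne_empty
  have hfilter : (Finset.univ.filter fun P : Finpartition (Finset.univ : Finset (Fin (n + 1))) =>
      P.parts = {Finset.univ}) = {Finpartition.indiscrete hne} := by
    ext P
    simp [Finpartition.ext_iff]
  rw [hfilter, Finset.sum_singleton]
  ext f
  rw [partitionProd_apply, Finpartition.indiscrete_parts, Finset.prod_singleton,
    apply_orderIsoOfFin_univ]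

theorem isTruncatedFamily_iff {V : Type*} [AddCommGroup V] [Module ℂ V]
    {ω ωT : ∀ n, MultilinearMap ℂ (fun _ : Fin n => V) ℂ} :
    IsTruncatedFamily ω ωT ↔
      ∀ n : ℕ, ω (n + 1) = ωT (n + 1) + properPartitionSum ωT (n + 1) := by
  refine forall_congr' fun n => ?_
  rw [← sum_partitionProd, MultilinearMap.ext_iff]
  simp only [sum_apply, partitionProd_apply]

/-- The truncated functionals of `ω`, obtained by solving the defining relation recursively. -/
noncomputable def truncatedFamily {V : Type*} [AddCommGroup V] [Module ℂ V]
    (ω : ∀ n, MultilinearMap ℂ (fun _ : Fin n => V) ℂ) (n : ℕ) :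
    MultilinearMap ℂ (fun _ : Fin n => V) ℂ :=
  ω n - properPartitionSum (fun k => if _h : k < n then truncatedFamily ω k else 0) n
termination_by n

theorem isTruncatedFamily_truncatedFamily {V : Type*} [AddCommGroup V] [Module ℂ V]
    (ω : ∀ n, MultilinearMap ℂ (fun _ : Fin n => V) ℂ) :
    IsTruncatedFamily ω (truncatedFamily ω) := by
  refine isTruncatedFamily_iff.2 fun n => ?_
  rw [truncatedFamily, properPartitionSum_congr (g' := truncatedFamily ω)
    (fun k _ hk => dif_pos hk), sub_add_cancel]

theorem IsTruncatedFamily.eq {V : Type*} [AddCommGroup V] [Module ℂ V]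
    {ω ωT ωT' : ∀ n, MultilinearMap ℂ (fun _ : Fin n => V) ℂ}
    (h : IsTruncatedFamily ω ωT) (h' : IsTruncatedFamily ω ωT') (n : ℕ) (hn : 1 ≤ n) :
    ωT n = ωT' n := by
  induction n using Nat.strong_induction_on with
  | _ n ih =>
    obtain ⟨m, rfl⟩ := Nat.exists_eq_add_of_le' hn
    have e := (isTruncatedFamily_iff.1 h m).symm.trans (isTruncatedFamily_iff.1 h' m)
    rw [properPartitionSum_congr fun k hk hkm => ih k hkm hk] at e
    exact add_right_cancel e

/-- Every family of `n`-point functionals `(ω_n)_{n ≥ 1}` admits a family of truncated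
functionals, which is unique (in degrees `n ≥ 1`). -/
theorem existsUnique_truncated_family {V : Type*} [AddCommGroup V] [Module ℂ V]
    (ω : ∀ n, MultilinearMap ℂ (fun _ : Fin n => V) ℂ) :
    ∃ ωT : ∀ n, MultilinearMap ℂ (fun _ : Fin n => V) ℂ,
      IsTruncatedFamily ω ωT ∧
        ∀ ωT' : ∀ n, MultilinearMap ℂ (fun _ : Fin n => V) ℂ,
          IsTruncatedFamily ω ωT' → ∀ n : ℕ, 1 ≤ n → ωT' n = ωT n := by
  exact ⟨truncatedFamily ω, isTruncatedFamily_truncatedFamily ω, fun _ h =>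
    h.eq (isTruncatedFamily_truncatedFamily ω)⟩
end
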